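/- Theorem 5.4 (combinatorial form): Let T be a symmetric numerical semigroup with 2 ∉ T, set F := F(T), and write T ∩ {0, 1, …, F − 1} = {0, a_1, …, a_n} with 0 < a_1 < ⋯ < a_n, and put d := a_n. Then: (i) d = F − 1 and gcd(a_1, …, a_n) = 1; (ii) the additive submonoid of ℕ generated by {a_1, …, a_n} equals T; (iii) the additive submonoid S of ℕ × ℕ generated by (0, d), (a_1, d − a_1), …, (a_{n−1}, d − a_{n−1}), (d, 0) satisfies: for every s ∈ ℤ × ℤ, if s + (0, d) ∈ S and s + (d, 0) ∈ S then s ∈ S; and (iv) (2d + 1, d − 1) belongs to AP_S and is the maximum of the poset (AP_S, ≤_S), i.e., y ≤_S (2d + 1, d − 1) for every y ∈ AP_S. -/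

import Mathlib

/-- The Apery set of a submonoid `S ⊆ ℕ × ℕ` with respect to `(0,d)` and `(d,0)`. -/
def AperyP (S : AddSubmonoid (ℕ × ℕ)) (d : ℕ) : Set (ℕ × ℕ) :=
  {y | y ∈ S ∧ (¬ ∃ s ∈ S, y = s + ((0 : ℕ), d)) ∧ (¬ ∃ s ∈ S, y = s + (d, (0 : ℕ)))}

/-- The partial order induced by a submonoid of `ℕ × ℕ`. -/
def leP (S : AddSubmonoid (ℕ × ℕ)) (y z : ℕ × ℕ) : Prop := ∃ s ∈ S, z = y + s

/-- The monoid `S ⊆ ℕ × ℕ` generated by `(0, d)`, `(a 1, d - a 1), …,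
`(a (n-1), d - a (n-1))` and `(d, 0)`. -/
def SmonG (n d : ℕ) (a : ℕ → ℕ) : AddSubmonoid (ℕ × ℕ) :=
  AddSubmonoid.closure
    {p | p = ((0 : ℕ), d) ∨ p = (d, (0 : ℕ)) ∨
      ∃ i, 1 ≤ i ∧ i ≤ n - 1 ∧ p = (a i, d - a i)}

/-- The image of `SmonG` inside `ℤ × ℤ`. -/
def SmonGZ (n d : ℕ) (a : ℕ → ℕ) : Set (ℤ × ℤ) :=
  {p | ∃ q ∈ SmonG n d a, p = ((q.1 : ℤ), (q.2 : ℤ))}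

/-- If `x - k ∈ T` for all `x ∈ T` with `k < x < G`, then `T` can be descended along
residues modulo `k`. -/
lemma mem_of_add_mul_mem {T : AddSubmonoid ℕ} {G k : ℕ}
    (h : ∀ x, k < x → x < G → x ∈ T → x - k ∈ T) (q r : ℕ) (hr : 1 ≤ r)
    (hlt : r + q * k < G) (hmem : r + q * k ∈ T) : r ∈ T := by
  induction q with
  | zero => simpa using hmem
  | succ q ih =>
    have e : r + (q + 1) * k = r + q * k + k := by ring
    rw [e] at hlt hmem
    have := h _ (by omega) hlt hmem
    rw [Nat.add_sub_cancel] at this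
    exact ih (by omega) this

lemma exists_eq_add_mul (k N : ℕ) (hk : 1 ≤ k) (hN : 1 ≤ N) :
    ∃ q r, 1 ≤ r ∧ r ≤ k ∧ N = r + q * k := by
  refine ⟨(N - 1) / k, (N - 1) % k + 1, by omega, Nat.mod_lt _ hk, ?_⟩
  have := Nat.mod_add_div' (N - 1) k
  omega

/-- If `T` meets every pair `{x, G - x}` and avoids `1` and `2`, then it contains everything
above `G`. -/
lemma mem_of_lt_of_or_mem {T : AddSubmonoid ℕ} {G : ℕ} (hG : 4 ≤ G) (h1 : 1 ∉ T) (h2 : 2 ∉ T)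
    (h : ∀ x, 1 ≤ x → x < G → x ∈ T ∨ G - x ∈ T) (y : ℕ) (hy : G < y) : y ∈ T := by
  classical
  have hG1 : G - 1 ∈ T := (h 1 le_rfl (by omega)).resolve_left h1
  have hG2 : G - 2 ∈ T := (h 2 (by omega) (by omega)).resolve_left h2
  have hex : ∃ x, x ∈ T ∧ 1 ≤ x := ⟨G - 1, hG1, by omega⟩
  obtain ⟨m, ⟨hmT, hm1⟩, hmin⟩ : ∃ m, (m ∈ T ∧ 1 ≤ m) ∧ ∀ x, x ∈ T → 1 ≤ x → m ≤ x :=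
    ⟨Nat.find hex, Nat.find_spec hex, fun x hx hx1 => Nat.find_min' hex ⟨hx, hx1⟩⟩
  have hm3 : 3 ≤ m := by
    by_contra hlt
    have : m = 1 ∨ m = 2 := by omega
    rcases this with rfl | rfl
    · exact h1 hmT
    · exact h2 hmT
  have hmG : m ≤ G - 2 := hmin _ hG2 (by omega)
  have key : ∀ k, 1 ≤ k → k ≤ m → G + k ∈ T := by
    intro k hk hkm
    by_contra hn
    have hdesc : ∀ x, k < x → x < G → x ∈ T → x - k ∈ T := by
      intro x hx hxG hxT
      refine (h (x - k) (by omega) (by omega)).resolve_right fun h' => hn ?_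
      have := T.add_mem hxT h'
      rwa [show x + (G - (x - k)) = G + k by omega] at this
    have hdvd : ∀ N, N ∈ T → 1 ≤ N → N < G → m ∣ N := by
      intro N hN hN1 hNG
      obtain ⟨q, r, hr1, hrk, rfl⟩ := exists_eq_add_mul k N hk hN1
      have hrm := hmin r (mem_of_add_mul_mem hdesc q r hr1 hNG hN) hr1
      obtain rfl : r = m := by omega
      obtain rfl : k = r := by omega
      exact ⟨q + 1, by ring⟩
    have hdiff := Nat.dvd_sub (hdvd _ hG1 (by omega) (by omega)) (hdvd _ hG2 (by omega) (by omega))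
    rw [show G - 1 - (G - 2) = 1 by omega] at hdiff
    have := Nat.le_of_dvd one_pos hdiff
    omega
  induction y using Nat.strong_induction_on with
  | _ y ih =>
    by_cases hle : y ≤ G + m
    · have := key (y - G) (by omega) (by omega)
      rwa [show G + (y - G) = y by omega] at this
    · have := T.add_mem (ih (y - m) (by omega) (by omega)) hmT
      rwa [show y - m + m = y by omega] at this

/-- In a symmetric numerical semigroup with Frobenius number `F` avoiding `2`, every element of
`(F, 2F - 1)` is the sum of two elements smaller than `F`. -/
lemma exists_add_eq_of_symmetric {T : AddSubmonoid ℕ} {F : ℕ} (hF4 : 4 ≤ F) (hFT : F ∉ T)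
    (h1 : 1 ∉ T) (h2 : 2 ∉ T) (h : ∀ x, x ≤ F → x ∈ T ∨ F - x ∈ T)
    (k : ℕ) (hk : 1 ≤ k) (hkF : k < F - 1) :
    ∃ x ∈ T, ∃ y ∈ T, x < F ∧ y < F ∧ x + y = F + k := by
  by_contra! hn
  have hdesc : ∀ x, k < x → x < F → x ∈ T → x - k ∈ T := by
    intro x hx hxF hxT
    refine (h (x - k) (by omega)).resolve_right fun h' => ?_
    exact hn x hxT _ h' hxF (by omega) (by omega)
  have hF1 : F - 1 ∈ T := (h 1 (by omega)).resolve_left h1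
  obtain ⟨q, r, hr1, hrk, hr⟩ := exists_eq_add_mul k (F - 1) hk (by omega)
  have hrT : r ∈ T := mem_of_add_mul_mem hdesc q r hr1 (by omega) (hr ▸ hF1)
  have hr3 : 3 ≤ r := by
    by_contra hlt
    have : r = 1 ∨ r = 2 := by omega
    rcases this with rfl | rfl
    · exact h1 hrT
    · exact h2 hrT
  refine hFT (mem_of_lt_of_or_mem (G := r + 1) (by omega) h1 h2 (fun x hx1 hx => ?_) F (by omega))
  refine (h x (by omega)).imp_right fun hx' => ?_
  rw [show F - x = (r + 1 - x) + q * k by omega] at hx'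
  exact mem_of_add_mul_mem hdesc q _ (by omega) (by omega) hx'

/-- The homogenized monoid consists of all points of `T × ℕ` whose coordinate sum is divisible
by `d`. -/
lemma mem_SmonG_iff {T : AddSubmonoid ℕ} {n d : ℕ} {a : ℕ → ℕ} (hd4 : 3 ≤ d)
    (hdT : d + 1 ∉ T) (h1 : 1 ∉ T) (h2 : 2 ∉ T) (h : ∀ x, x ≤ d + 1 → x ∈ T ∨ d + 1 - x ∈ T)
    (hbig : ∀ x, d + 1 < x → x ∈ T) (hd : d = a n)
    (hgen : ∀ x, (x ∈ T ∧ x ≤ d) ↔ (x = 0 ∨ ∃ i, 1 ≤ i ∧ i ≤ n ∧ x = a i)) (p : ℕ × ℕ) :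
    p ∈ SmonG n d a ↔ p.1 ∈ T ∧ ∃ j, p.1 + p.2 = j * d := by
  have hdm : d ∈ T := by simpa using (h 1 (by omega)).resolve_left h1
  have hdm' : d - 1 ∈ T := by
    have := (h 2 (by omega)).resolve_left h2
    rwa [show d + 1 - 2 = d - 1 by omega] at this
  constructor
  · intro hp
    induction hp using AddSubmonoid.closure_induction with
    | mem p hp =>
      rcases hp with rfl | rfl | ⟨i, hi1, hin, rfl⟩
      · exact ⟨T.zero_mem, 1, by simp⟩
      · exact ⟨hdm, 1, by simp⟩
      · obtain ⟨hT, hle⟩ := (hgen (a i)).2 (Or.inr ⟨i, hi1, by omega, rfl⟩)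
        exact ⟨hT, 1, by simp only; omega⟩
    | zero => exact ⟨T.zero_mem, 0, by simp⟩
    | add p p' _ _ ih ih' =>
      obtain ⟨hT, j, hj⟩ := ih
      obtain ⟨hT', j', hj'⟩ := ih'
      refine ⟨T.add_mem hT hT', j + j', ?_⟩
      rw [add_mul, ← hj, ← hj', Prod.fst_add, Prod.snd_add]
      ring
  · obtain ⟨u, v⟩ := p
    rintro ⟨hu, j, hj⟩
    simp only at hu hj
    have hone : ∀ x, x ∈ T → x ≤ d → (x, d - x) ∈ SmonG n d a := by
      intro x hx hxd
      rcases (hgen x).1 ⟨hx, hxd⟩ with rfl | ⟨i, hi1, hin, rfl⟩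
      · exact AddSubmonoid.subset_closure (Or.inl (by simp))
      · rcases hin.eq_or_lt with rfl | hlt
        · exact AddSubmonoid.subset_closure (Or.inr (Or.inl (by simp [hd])))
        · exact AddSubmonoid.subset_closure (Or.inr (Or.inr ⟨i, hi1, by omega, rfl⟩))
    have hstep : ∀ x u v, x ∈ T → x ≤ d → x ≤ u → d - x ≤ v →
        (u - x, v - (d - x)) ∈ SmonG n d a → (u, v) ∈ SmonG n d a := by
      intro x u v hx hxd hxu hxv hmem
      have := (SmonG n d a).add_mem hmem (hone x hx hxd)
      rwa [Prod.mk_add_mk, Nat.sub_add_cancel hxu, Nat.sub_add_cancel hxv] at this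
    induction j generalizing u v with
    | zero =>
      obtain ⟨rfl, rfl⟩ : u = 0 ∧ v = 0 := by omega
      exact (SmonG n d a).zero_mem
    | succ j ih =>
      rw [add_one_mul] at hj
      have hsplit : ∀ x, x ∈ T → x ≤ d → x ≤ u → d - x ≤ v → u - x ∈ T →
          (u, v) ∈ SmonG n d a := fun x hx hxd hxu hxv hT =>
        hstep x u v hx hxd hxu hxv (ih _ _ hT (by omega))
      by_cases hv : d ≤ v
      · exact hsplit 0 T.zero_mem (by omega) (by omega) (by omega) hu
      by_cases hud : d ≤ u ∧ u - d ∈ T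
      · exact hsplit d hdm le_rfl hud.1 (by omega) hud.2
      rcases j with _ | j
      · have := hone u hu (by omega)
        rwa [show d - u = v by omega] at this
      rw [add_one_mul] at hj
      have hu2 : u ≤ 2 * d + 1 := by
        by_contra hlt
        exact hud ⟨by omega, hbig _ (by omega)⟩
      have hne : u ≠ d + 1 := fun he => hdT (he ▸ hu)
      have hne' : u ≠ d := fun he => hud ⟨he.ge, by simp [he]⟩
      by_cases hu3 : u = 2 * d + 1
      · have hj1 : 1 ≤ j := by
          by_contra hj0
          obtain rfl : j = 0 := by omega
          omega
        have : d ≤ j * d := Nat.le_mul_of_pos_left d hj1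
        exact hsplit (d - 1) hdm' (by omega) (by omega) (by omega) (hbig _ (by omega))
      · obtain ⟨x, hx, y, hy, hxF, hyF, hxy⟩ :=
          exists_add_eq_of_symmetric (F := d + 1) (by omega) hdT h1 h2 h (u - (d + 1))
            (by omega) (by omega)
        refine hsplit x hx (by omega) (by omega) (by omega) ?_
        rwa [show u - x = y by omega]

/-- Theorem 5.4 (combinatorial form): let `T` be a symmetric numerical semigroup with
`2 ∉ T`, `F = F(T)`, and let `0 < a 1 < ⋯ < a n` enumerate the nonzero elements of
`T ∩ [0, F - 1]`, `d = a n`. Then `d = F - 1` and `gcd(a 1, …, a n) = 1`; the submonoid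
generated by `a 1, …, a n` is `T`; the homogenized monoid `S` satisfies the
Cohen–Macaulay criterion; and `(2d + 1, d - 1)` is the maximum of `(AP_S, ≤_S)`. -/
theorem stmt19 (T : AddSubmonoid ℕ) (hfin : {x : ℕ | x ∉ T}.Finite)
    (F : ℤ) (hF : IsGreatest {x : ℤ | ¬ ∃ y : ℕ, y ∈ T ∧ (y : ℤ) = x} F)
    (hsym : ∀ x : ℤ, (∃ y : ℕ, y ∈ T ∧ (y : ℤ) = x) ∨ (∃ y : ℕ, y ∈ T ∧ (y : ℤ) = F - x))
    (h2 : (2 : ℕ) ∉ T)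
    (n : ℕ) (hn : 1 ≤ n) (a : ℕ → ℕ) (ha1 : 0 < a 1)
    (hmono : ∀ i k, 1 ≤ i → i < k → k ≤ n → a i < a k)
    (hset : {x : ℕ | x ∈ T ∧ (x : ℤ) < F} =
      {0} ∪ {x : ℕ | ∃ i, 1 ≤ i ∧ i ≤ n ∧ x = a i})
    (d : ℕ) (hd : d = a n) :
    ((d : ℤ) = F - 1 ∧ Finset.gcd (Finset.Icc 1 n) a = 1)
    ∧
    (AddSubmonoid.closure {x : ℕ | ∃ i, 1 ≤ i ∧ i ≤ n ∧ x = a i} = T)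
    ∧
    (∀ s : ℤ × ℤ, s + ((0 : ℤ), (d : ℤ)) ∈ SmonGZ n d a →
      s + ((d : ℤ), (0 : ℤ)) ∈ SmonGZ n d a → s ∈ SmonGZ n d a)
    ∧
    (((2 * d + 1, d - 1) : ℕ × ℕ) ∈ AperyP (SmonG n d a) d ∧
      ∀ y ∈ AperyP (SmonG n d a) d, leP (SmonG n d a) y (2 * d + 1, d - 1)) := by
  obtain ⟨hFn, hFmax⟩ := hF
  have h1 : (1 : ℕ) ∉ T := fun h => h2 (T.add_mem h h)
  have hF2 : 2 ≤ F := hFmax (by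
    rintro ⟨y, hy, hy2⟩
    obtain rfl : y = 2 := by exact_mod_cast hy2
    exact h2 hy)
  lift F to ℕ using by omega
  have hFT : F ∉ T := fun h => hFn ⟨F, h, rfl⟩
  have hsymN : ∀ x, x ≤ F → x ∈ T ∨ F - x ∈ T := by
    intro x hx
    rcases hsym x with ⟨y, hy, hyx⟩ | ⟨y, hy, hyx⟩
    · obtain rfl : y = x := by omega
      exact Or.inl hy
    · obtain rfl : y = F - x := by omega
      exact Or.inr hy
  have hbigF : ∀ x, F < x → x ∈ T := by
    intro x hx
    by_contra hxT
    have : (x : ℤ) ≤ F := hFmax (by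
      rintro ⟨y, hy, hyx⟩
      obtain rfl : y = x := by exact_mod_cast hyx
      exact hxT hy)
    omega
  have hF1 : F - 1 ∈ T := (hsymN 1 (by omega)).resolve_left h1
  have hF4 : 4 ≤ F := by
    by_contra hlt
    have : F = 2 ∨ F = 3 := by omega
    rcases this with rfl | rfl
    · exact h1 hF1
    · exact h2 hF1
  have hgenF : ∀ x, (x ∈ T ∧ x < F) ↔ (x = 0 ∨ ∃ i, 1 ≤ i ∧ i ≤ n ∧ x = a i) := by
    intro x
    have := Set.ext_iff.1 hset x
    simpa using this
  have hdF : F = d + 1 := by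
    have hd1 := ((hgenF d).2 (Or.inr ⟨n, hn, le_rfl, hd⟩)).2
    rcases (hgenF (F - 1)).1 ⟨hF1, by omega⟩ with h0 | ⟨i, hi1, hin, hi⟩
    · omega
    · rcases hin.eq_or_lt with rfl | hlt
      · omega
      · have := hmono i n hi1 hlt le_rfl
        omega
  subst hdF
  have hgen : ∀ x, (x ∈ T ∧ x ≤ d) ↔ (x = 0 ∨ ∃ i, 1 ≤ i ∧ i ≤ n ∧ x = a i) := by
    intro x
    rw [← hgenF, Nat.lt_succ_iff]
  have hdT : d ∈ T := by simpa using hF1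
  have hdT' : d - 1 ∈ T := by
    have := (hsymN 2 (by omega)).resolve_left h2
    rwa [show d + 1 - 2 = d - 1 by omega] at this
  have hS := mem_SmonG_iff (by omega) hFT h1 h2 hsymN hbigF hd hgen
  refine ⟨⟨by push_cast; ring, ?_⟩, ?_, ?_, ?_, ?_⟩
  · rcases (hgen (d - 1)).1 ⟨hdT', by omega⟩ with h0 | ⟨i, hi1, hin, hi⟩
    · omega
    have hdvd1 : (Finset.Icc 1 n).gcd a ∣ d := hd ▸ Finset.gcd_dvd (by simp [hn])
    have hdvd2 : (Finset.Icc 1 n).gcd a ∣ d - 1 := hi ▸ Finset.gcd_dvd (by simp [hi1, hin])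
    have := Nat.dvd_sub hdvd1 hdvd2
    rw [show d - (d - 1) = 1 by omega] at this
    exact Nat.dvd_one.1 this
  · apply le_antisymm
    · rw [AddSubmonoid.closure_le]
      rintro x hx
      exact ((hgen x).2 (Or.inr hx)).1
    · intro u hu
      induction u using Nat.strong_induction_on with
      | _ u ih =>
        by_cases hud : u ≤ d
        · rcases (hgen u).1 ⟨hu, hud⟩ with rfl | hi
          · exact AddSubmonoid.zero_mem _
          · exact AddSubmonoid.subset_closure hi
        have hne : u ≠ d + 1 := fun he => hFT (he ▸ hu)
        obtain ⟨x, hx, y, hy, hxu, hyu, rfl⟩ : ∃ x ∈ T, ∃ y ∈ T, x < u ∧ y < u ∧ u = x + y := by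
          rcases lt_trichotomy u (2 * d + 1) with hlt | rfl | hlt
          · obtain ⟨x, hx, y, hy, hxF, hyF, hxy⟩ :=
              exists_add_eq_of_symmetric hF4 hFT h1 h2 hsymN (u - (d + 1)) (by omega) (by omega)
            exact ⟨x, hx, y, hy, by omega, by omega, by omega⟩
          · exact ⟨d - 1, hdT', d + 2, hbigF _ (by omega), by omega, by omega, by omega⟩
          · exact ⟨d, hdT, u - d, hbigF _ (by omega), by omega, by omega, by omega⟩
        exact AddSubmonoid.add_mem _ (ih x hxu hx) (ih y hyu hy)
  · rintro ⟨u, v⟩ ⟨⟨u₁, v₁⟩, hq, he⟩ ⟨⟨u₂, v₂⟩, hq', he'⟩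
    simp only [Prod.mk_add_mk, Prod.mk.injEq, add_zero] at he he'
    obtain ⟨rfl, he⟩ := he
    obtain ⟨he', rfl⟩ := he'
    obtain ⟨hT, j, hj⟩ := (hS _).1 hq
    simp only at hT hj
    refine ⟨(u₁, v₂), (hS _).2 ⟨hT, j - 1, ?_⟩, rfl⟩
    rw [Nat.sub_one_mul]
    simp only
    omega
  · refine ⟨(hS _).2 ⟨hbigF _ (by omega), 3, by simp only; omega⟩, ?_, ?_⟩
    · rintro ⟨⟨u, v⟩, -, he⟩
      simp only [Prod.mk_add_mk, Prod.mk.injEq] at he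
      omega
    · rintro ⟨⟨u, v⟩, hs, he⟩
      simp only [Prod.mk_add_mk, Prod.mk.injEq] at he
      have := ((hS _).1 hs).1
      simp only at this
      rw [show u = d + 1 by omega] at this
      exact hFT this
  · rintro ⟨u, v⟩ ⟨hy, hy1, hy2⟩
    obtain ⟨hT, j, hj⟩ := (hS _).1 hy
    simp only at hT hj
    have hv : v < d := by
      by_contra hle
      refine hy1 ⟨(u, v - d), (hS _).2 ⟨hT, j - 1, ?_⟩, ?_⟩
      · rw [Nat.sub_one_mul]
        simp only
        omega
      · simp only [Prod.mk_add_mk, Prod.mk.injEq]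
        omega
    have hu : ¬ (d ≤ u ∧ u - d ∈ T) := by
      rintro ⟨hle, hmem⟩
      refine hy2 ⟨(u - d, v), (hS _).2 ⟨hmem, j - 1, ?_⟩, ?_⟩
      · rw [Nat.sub_one_mul]
        simp only
        omega
      · simp only [Prod.mk_add_mk, Prod.mk.injEq]
        omega
    have hu2 : u ≤ 2 * d + 1 := by
      by_contra hlt
      exact hu ⟨by omega, hbigF _ (by omega)⟩
    have hmem : 2 * d + 1 - u ∈ T := by
      by_cases hle : d ≤ u
      · have := (hsymN (u - d) (by omega)).resolve_left fun h => hu ⟨hle, h⟩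
        rwa [show d + 1 - (u - d) = 2 * d + 1 - u by omega] at this
      · exact hbigF _ (by omega)
    refine ⟨(2 * d + 1 - u, d - 1 - v), (hS _).2 ⟨hmem, 3 - j, ?_⟩, ?_⟩
    · rw [Nat.sub_mul]
      simp only
      omega
    · simp only [Prod.mk_add_mk, Prod.mk.injEq]
      omega
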